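/- arXiv:0908.4222 — 4 statements merged into one kernel-verified Lean document; each statement's English description precedes it below -/
import Mathlib

section
/- Let α be a real number and let C₁, C₃ > 0 and C₂ ≥ 0 be real constants. Then the improper integral ∫₁^∞ (C₂ + C₃·exp(r^α)) / (C₁·r^(α−1)·exp(r^α)) dr diverges (equals +∞) if and only if α ≤ 2. -/
open MeasureTheory Real

theorem lintegral_Ici_one_rpow_eq_top_iff (s : ℝ) :
    ∫⁻ r in Set.Ici (1 : ℝ), ENNReal.ofReal (r ^ s) = ⊤ ↔ -1 ≤ s := by
  have hmeas : AEStronglyMeasurable (fun r : ℝ ↦ r ^ s) (volume.restrict (Set.Ici 1)) :=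
    (measurable_id.pow_const s).aestronglyMeasurable
  have hnonneg : 0 ≤ᵐ[volume.restrict (Set.Ici (1 : ℝ))] fun r : ℝ ↦ r ^ s :=
    (ae_restrict_mem measurableSet_Ici).mono fun r hr ↦
      rpow_nonneg (zero_le_one.trans (Set.mem_Ici.mp hr)) s
  have h := lintegral_ofReal_ne_top_iff_integrable hmeas hnonneg
  rw [← not_iff_not, ← ne_eq, h, not_le]
  exact (integrableOn_Ici_iff_integrableOn_Ioi (f := fun r : ℝ ↦ r ^ s)).trans
    (integrableOn_Ioi_rpow_iff one_pos)

theorem setLIntegral_ofReal_eq_top_of_le_mul {f g : ℝ → ℝ} {c : ℝ} {t : Set ℝ}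
    (ht : MeasurableSet t) (hc : 0 ≤ c) (hfg : ∀ r ∈ t, f r ≤ c * g r)
    (hf : ∫⁻ r in t, ENNReal.ofReal (f r) = ⊤) :
    ∫⁻ r in t, ENNReal.ofReal (g r) = ⊤ := by
  by_contra hg
  have hle : ∫⁻ r in t, ENNReal.ofReal (f r) ≤
      ENNReal.ofReal c * ∫⁻ r in t, ENNReal.ofReal (g r) := by
    rw [← lintegral_const_mul' _ _ ENNReal.ofReal_ne_top]
    refine setLIntegral_mono' ht fun r hr ↦ ?_
    rw [← ENNReal.ofReal_mul hc]
    exact ENNReal.ofReal_le_ofReal (hfg r hr)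
  exact ENNReal.mul_ne_top ENNReal.ofReal_ne_top hg (top_le_iff.mp (hf ▸ hle))

/-- The improper integral ∫₁^∞ (C₂ + C₃·exp(r^α)) / (C₁·r^(α−1)·exp(r^α)) dr
diverges (equals +∞) if and only if α ≤ 2. -/
theorem stmt_0 (α C₁ C₂ C₃ : ℝ) (hC₁ : 0 < C₁) (hC₂ : 0 ≤ C₂) (hC₃ : 0 < C₃) :
    (∫⁻ r in Set.Ici (1 : ℝ),
      ENNReal.ofReal ((C₂ + C₃ * Real.exp (r ^ α)) /
        (C₁ * r ^ (α - 1) * Real.exp (r ^ α))) = ⊤) ↔ α ≤ 2 := by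
  have hpow : ∀ r ∈ Set.Ici (1 : ℝ), 0 < r ^ (α - 1) ∧ r ^ (1 - α) = (r ^ (α - 1))⁻¹ := by
    intro r hr
    have hr0 : 0 < r := one_pos.trans_le hr
    exact ⟨rpow_pos_of_pos hr0 _, by rw [← rpow_neg hr0.le, neg_sub]⟩
  have hiff : α ≤ 2 ↔ -1 ≤ 1 - α := by constructor <;> intro h <;> linarith
  rw [hiff, ← lintegral_Ici_one_rpow_eq_top_iff]
  constructor
  · refine setLIntegral_ofReal_eq_top_of_le_mul (c := (C₂ + C₃) / C₁) measurableSet_Ici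
      (by positivity) fun r hr ↦ ?_
    obtain ⟨hp, hinv⟩ := hpow r hr
    have hexp : 1 ≤ exp (r ^ α) :=
      one_le_exp (rpow_nonneg (zero_le_one.trans (Set.mem_Ici.mp hr)) α)
    rw [hinv, ← div_eq_mul_inv, div_div, div_le_div_iff₀ (by positivity) (by positivity)]
    have hnum : C₂ + C₃ * exp (r ^ α) ≤ (C₂ + C₃) * exp (r ^ α) := by nlinarith
    calc (C₂ + C₃ * exp (r ^ α)) * (C₁ * r ^ (α - 1))
        ≤ ((C₂ + C₃) * exp (r ^ α)) * (C₁ * r ^ (α - 1)) := by gcongr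
      _ = (C₂ + C₃) * (C₁ * r ^ (α - 1) * exp (r ^ α)) := by ring
  · refine setLIntegral_ofReal_eq_top_of_le_mul (c := C₁ / C₃) measurableSet_Ici
      (by positivity) fun r hr ↦ ?_
    obtain ⟨hp, hinv⟩ := hpow r hr
    have hexp := exp_pos (r ^ α)
    rw [hinv]
    calc (r ^ (α - 1))⁻¹
        = C₁ / C₃ * (C₃ * exp (r ^ α) / (C₁ * r ^ (α - 1) * exp (r ^ α))) := by field_simp
      _ ≤ C₁ / C₃ * ((C₂ + C₃ * exp (r ^ α)) / (C₁ * r ^ (α - 1) * exp (r ^ α))) := by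
        gcongr
        linarith
end

section
/- Let V : ℝ → ℝ be differentiable with V(0) = 0 and S := V' > 0 on [0, ∞), and suppose S is constant on every interval [k + 1/8, k + 3/4] for integers k ≥ 1. Let F : ℝ → ℝ be nondecreasing on [0, ∞) with F(k + 1) ≤ V(k) for all integers k ≥ 1. Let S₁ : ℝ → ℝ be nonnegative with S₁(ρ) ≤ F(r) whenever 0 ≤ ρ ≤ r, let V₁ : ℝ → ℝ be nonnegative on [1, ∞), and let V₂ : ℝ → ℝ be differentiable with S₂ := V₂' > 0 on [1, ∞) and V(r − 1/8) ≤ V₂(r) ≤ V(r) for all r ≥ 1. Then ∫₁^∞ (V₁(r) + V₂(r)) / (S₁(r) + S₂(r)) dr = ∞. -/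
open MeasureTheory

/-- The integral of a real function is at most the lower integral of its positive part. -/
lemma ofReal_integral_le_lintegral_ofReal {α : Type*} [MeasurableSpace α] {μ : Measure α}
    {f : α → ℝ} (hf : Integrable f μ) :
    ENNReal.ofReal (∫ x, f x ∂μ) ≤ ∫⁻ x, ENNReal.ofReal (f x) ∂μ := by
  rw [integral_eq_lintegral_pos_part_sub_lintegral_neg_part hf]
  refine ENNReal.ofReal_le_of_le_toReal ?_
  linarith [ENNReal.toReal_nonneg (a := ∫⁻ x, ENNReal.ofReal (-f x) ∂μ)]

/-- Integrated tangent-line form of Jensen's inequality for `x ↦ 1 / x`. -/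
lemma ofReal_le_lintegral_div_add_deriv {f : ℝ → ℝ} (hf : Differentiable ℝ f) {p q a N t : ℝ}
    (hpq : p ≤ q) (hf' : ∀ r ∈ Set.Icc p q, 0 < deriv f r) (ha : 0 < a) (hN : 0 ≤ N) (ht : 0 < t)
    (hmean : a * (q - p) + (f q - f p) ≤ t * (q - p)) :
    ENNReal.ofReal (N / t * (q - p)) ≤
      ∫⁻ r in Set.Ioc p q, ENNReal.ofReal (N / (a + deriv f r)) := by
  have hint : IntervalIntegrable (deriv f) volume p q := by
    refine intervalIntegral.intervalIntegrable_deriv_of_nonneg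
      hf.continuous.continuousOn (fun x _ => (hf x).hasDerivAt) fun x hx => ?_
    rw [min_eq_left hpq, max_eq_right hpq] at hx
    exact (hf' x (Set.Ioo_subset_Icc_self hx)).le
  have hftc : ∫ r in p..q, deriv f r = f q - f p :=
    intervalIntegral.integral_eq_sub_of_hasDerivAt (fun x _ => (hf x).hasDerivAt) hint
  have hg : IntervalIntegrable (fun r => N * (2 / t - a / t ^ 2) - N / t ^ 2 * deriv f r)
      volume p q := intervalIntegrable_const.sub (hint.const_mul _)
  have hval : ∫ r in p..q, (N * (2 / t - a / t ^ 2) - N / t ^ 2 * deriv f r) =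
      (q - p) * (N * (2 / t - a / t ^ 2)) - N / t ^ 2 * (f q - f p) := by
    rw [intervalIntegral.integral_sub intervalIntegrable_const (hint.const_mul _),
      intervalIntegral.integral_const, intervalIntegral.integral_const_mul (N / t ^ 2), hftc,
      smul_eq_mul]
  calc ENNReal.ofReal (N / t * (q - p))
      ≤ ENNReal.ofReal (∫ r in p..q, (N * (2 / t - a / t ^ 2) - N / t ^ 2 * deriv f r)) := by
        refine ENNReal.ofReal_le_ofReal ?_
        rw [hval]
        have h := mul_le_mul_of_nonneg_left hmean (by positivity : 0 ≤ N / t ^ 2)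
        have e : N / t ^ 2 * (t * (q - p)) = N / t * (q - p) := by field_simp
        have e' : (q - p) * (N * (2 / t - a / t ^ 2)) =
            2 * (N / t * (q - p)) - N / t ^ 2 * (a * (q - p)) := by field_simp
        rw [e']
        linarith
    _ ≤ ∫⁻ r in Set.Ioc p q,
          ENNReal.ofReal (N * (2 / t - a / t ^ 2) - N / t ^ 2 * deriv f r) := by
        rw [intervalIntegral.integral_of_le hpq]
        exact ofReal_integral_le_lintegral_ofReal hg.1
    _ ≤ _ := by
        refine setLIntegral_mono' measurableSet_Ioc fun r hr => ENNReal.ofReal_le_ofReal ?_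
        have hx : 0 < a + deriv f r := add_pos ha (hf' r (Set.Ioc_subset_Icc_self hr))
        rw [le_div_iff₀ hx]
        have e : (N * (2 / t - a / t ^ 2) - N / t ^ 2 * deriv f r) * (a + deriv f r) =
            N - N * ((a + deriv f r) / t - 1) ^ 2 := by field_simp; ring
        rw [e]
        linarith [mul_nonneg hN (sq_nonneg ((a + deriv f r) / t - 1))]

/-- A lower integral over a ray is infinite if the integral over one subinterval of every
unit interval is bounded below. -/
lemma lintegral_Ici_one_eq_top_of_le {g : ℝ → ENNReal} {c : ENNReal} (hc : c ≠ 0)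
    (h : ∀ k : ℕ, 1 ≤ k → c ≤ ∫⁻ r in Set.Ioc ((k : ℝ) + 1/2) ((k : ℝ) + 3/4), g r) :
    ∫⁻ r in Set.Ici (1 : ℝ), g r = ⊤ := by
  set I : ℕ → Set ℝ := fun n => Set.Ioc (((n + 1 : ℕ) : ℝ) + 1/2) (((n + 1 : ℕ) : ℝ) + 3/4)
  have hd : Pairwise (Function.onFun Disjoint I) := by
    refine (pairwise_disjoint_on I).2 fun m n hmn => Set.disjoint_left.2 fun x hx hy => ?_
    have : (m : ℝ) + 1 ≤ n := by exact_mod_cast hmn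
    have h₁ := hx.2
    have h₂ := hy.1
    push_cast at h₁ h₂
    linarith
  have hsub : (⋃ n, I n) ⊆ Set.Ici (1 : ℝ) := by
    refine Set.iUnion_subset fun n x hx => ?_
    have h₁ := hx.1
    push_cast at h₁
    have : (0 : ℝ) ≤ n := n.cast_nonneg
    exact Set.mem_Ici.2 (by linarith)
  refine top_unique ?_
  calc (⊤ : ENNReal) = ∑' _ : ℕ, c := (ENNReal.tsum_const_eq_top_of_ne_zero hc).symm
    _ ≤ ∑' n, ∫⁻ r in I n, g r := ENNReal.tsum_le_tsum fun n => h (n + 1) (by omega)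
    _ = ∫⁻ r in ⋃ n, I n, g r := (lintegral_iUnion (fun _ => measurableSet_Ioc) hd g).symm
    _ ≤ _ := lintegral_mono_set hsub

/-- Analytic core of the main theorem: under the stated hypotheses the volume growth
integral ∫₁^∞ (V₁ + V₂)/(S₁ + S₂) dr diverges (equals +∞). -/
theorem stmt_8
    (V : ℝ → ℝ) (hV : Differentiable ℝ V) (hV0 : V 0 = 0)
    (hS : ∀ r : ℝ, 0 ≤ r → 0 < deriv V r)
    (hconst : ∀ k : ℕ, 1 ≤ k →
      ∀ x ∈ Set.Icc ((k : ℝ) + 1/8) ((k : ℝ) + 3/4),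
      ∀ y ∈ Set.Icc ((k : ℝ) + 1/8) ((k : ℝ) + 3/4), deriv V x = deriv V y)
    (F : ℝ → ℝ) (hF : MonotoneOn F (Set.Ici (0 : ℝ)))
    (hFV : ∀ k : ℕ, 1 ≤ k → F ((k : ℝ) + 1) ≤ V (k : ℝ))
    (S₁ : ℝ → ℝ) (hS₁0 : ∀ r : ℝ, 0 ≤ S₁ r)
    (hS₁F : ∀ ρ r : ℝ, 0 ≤ ρ → ρ ≤ r → S₁ ρ ≤ F r)
    (V₁ : ℝ → ℝ) (hV₁ : ∀ r : ℝ, 1 ≤ r → 0 ≤ V₁ r)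
    (V₂ : ℝ → ℝ) (hV₂ : Differentiable ℝ V₂)
    (hS₂ : ∀ r : ℝ, 1 ≤ r → 0 < deriv V₂ r)
    (hsand : ∀ r : ℝ, 1 ≤ r → V (r - 1/8) ≤ V₂ r ∧ V₂ r ≤ V r) :
    ∫⁻ r in Set.Ici (1 : ℝ),
      ENNReal.ofReal ((V₁ r + V₂ r) / (S₁ r + deriv V₂ r)) = ⊤ := by
  refine lintegral_Ici_one_eq_top_of_le (c := ENNReal.ofReal (1/24))
    (by norm_num) fun k hk => ?_
  have hk1 : (1 : ℝ) ≤ k := by exact_mod_cast hk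
  have hmono : StrictMonoOn V (Set.Ici 0) := by
    refine strictMonoOn_of_deriv_pos (convex_Ici 0) hV.continuous.continuousOn fun x hx => ?_
    exact hS x (interior_subset hx)
  set c := deriv V (k + 1/8)
  have hc : 0 < c := hS _ (by linarith)
  have haff : ∀ x : ℝ, k + 1/8 < x → x ≤ k + 3/4 →
      V x = V (k + 1/8) + c * (x - (k + 1/8)) := by
    intro x hx hx'
    obtain ⟨ξ, hξ, e⟩ := exists_deriv_eq_slope V hx hV.continuous.continuousOn
      hV.differentiableOn
    rw [hconst k hk ξ ⟨hξ.1.le, hξ.2.le.trans hx'⟩ (k + 1/8) ⟨le_rfl, by linarith⟩,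
      eq_div_iff (by linarith)] at e
    linarith
  set a := V (k + 1/8)
  have hVk : V k < a := hmono (Set.mem_Ici.2 (by linarith)) (Set.mem_Ici.2 (by linarith))
    (by linarith)
  have hVk0 : 0 < V k := hV0 ▸ hmono (Set.mem_Ici.2 le_rfl) (Set.mem_Ici.2 (by linarith))
    (by linarith)
  have ha : 0 < a := hVk0.trans hVk
  have hlow : a + c / 4 ≤ V₂ (k + 1/2) := by
    have h := (hsand (k + 1/2) (by linarith)).1
    rw [haff _ (by linarith) (by linarith)] at h
    linarith
  have hup : V₂ (k + 3/4) ≤ a + 5 * c / 8 := by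
    have h := (hsand (k + 3/4) (by linarith)).2
    rw [haff _ (by linarith) le_rfl] at h
    linarith
  have hmono₂ : MonotoneOn V₂ (Set.Ici 1) := by
    refine monotoneOn_of_deriv_nonneg (convex_Ici 1) hV₂.continuous.continuousOn
      hV₂.differentiableOn fun x hx => ?_
    exact (hS₂ x (interior_subset hx)).le
  calc ENNReal.ofReal (1/24)
      ≤ ENNReal.ofReal ((a + c / 4) / (a + 3 * c / 2) * ((k + 3/4) - (k + 1/2))) := by
        refine ENNReal.ofReal_le_ofReal ?_
        have : 1/6 ≤ (a + c / 4) / (a + 3 * c / 2) := by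
          rw [le_div_iff₀ (by positivity)]
          linarith
        linarith
    _ ≤ ∫⁻ r in Set.Ioc ((k : ℝ) + 1/2) (k + 3/4),
          ENNReal.ofReal ((a + c / 4) / (a + deriv V₂ r)) :=
        ofReal_le_lintegral_div_add_deriv hV₂ (by linarith)
          (fun r hr => hS₂ r (by linarith [hr.1])) ha (by positivity) (by positivity)
          (by linarith)
    _ ≤ _ := by
        refine setLIntegral_mono' measurableSet_Ioc fun r hr => ENNReal.ofReal_le_ofReal ?_
        obtain ⟨hr₁, hr₂⟩ := hr
        have hS₁r : S₁ r ≤ a :=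
          ((hS₁F r (k + 1) (by linarith) (by linarith)).trans (hFV k hk)).trans hVk.le
        have hV₂r : a + c / 4 ≤ V₂ r := hlow.trans
          (hmono₂ (Set.mem_Ici.2 (by linarith)) (Set.mem_Ici.2 (by linarith)) hr₁.le)
        have := hS₂ r (by linarith)
        have := hS₁0 r
        have := hV₁ r (by linarith)
        apply div_le_div₀ <;> linarith
end

section
/- Let F : ℝ → ℝ be nondecreasing and nonnegative on [0, ∞). Then there exists an infinitely differentiable function V : ℝ → ℝ such that V(0) = 0, V'(r) > 0 for all r ≥ 0, V(k) ≥ F(k + 1) for every integer k ≥ 1, and V' is constant on each interval [k + 1/8, k + 3/4] for integers k ≥ 1. -/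
open Real

/-- The identity plus smooth steps of height `c k`, the `k`-th one on `[k + 7/8, k + 1]`,
for `k < N`. -/
noncomputable def stepSum (c : ℕ → ℝ) (N : ℕ) (x : ℝ) : ℝ :=
  x + ∑ k ∈ Finset.range N, c k * smoothTransition (8 * (x - k) - 7)

/-- The identity plus all smooth steps of height `c k` on `[k + 7/8, k + 1]`. -/
noncomputable def smoothStaircase (c : ℕ → ℝ) (x : ℝ) : ℝ :=
  stepSum c ⌈x⌉₊ x

theorem smoothStaircase_eq_stepSum (c : ℕ → ℝ) {N : ℕ} {x : ℝ} (hx : x ≤ N) :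
    smoothStaircase c x = stepSum c N x := by
  unfold smoothStaircase stepSum
  congr 1
  refine Finset.sum_subset (Finset.range_mono (Nat.ceil_le.2 hx)) fun k _ hk => ?_
  have hxk : x ≤ k := Nat.ceil_le.1 (not_lt.1 fun h => hk (Finset.mem_range.2 h))
  rw [smoothTransition.zero_of_nonpos (by linarith), mul_zero]

theorem smoothStaircase_eventuallyEq (c : ℕ → ℝ) {N : ℕ} {x : ℝ} (hx : x < N) :
    smoothStaircase c =ᶠ[nhds x] stepSum c N := by
  filter_upwards [Iio_mem_nhds hx] with y hy
  exact smoothStaircase_eq_stepSum c (le_of_lt hy)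

theorem contDiff_stepSum (c : ℕ → ℝ) (N : ℕ) : ContDiff ℝ (⊤ : ℕ∞) (stepSum c N) :=
  contDiff_id.add <| ContDiff.sum fun _ _ =>
    contDiff_const.mul <| smoothTransition.contDiff.comp <|
      (contDiff_const.mul (contDiff_id.sub contDiff_const)).sub contDiff_const

theorem contDiff_smoothStaircase (c : ℕ → ℝ) : ContDiff ℝ (⊤ : ℕ∞) (smoothStaircase c) :=
  contDiff_iff_contDiffAt.2 fun x =>
    let ⟨_, hN⟩ := exists_nat_gt x
    (contDiff_stepSum c _).contDiffAt.congr_of_eventuallyEq (smoothStaircase_eventuallyEq c hN)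

theorem deriv_smoothStaircase_pos {c : ℕ → ℝ} (hc : ∀ k, 0 ≤ c k) (x : ℝ) :
    0 < deriv (smoothStaircase c) x := by
  obtain ⟨N, hN⟩ := exists_nat_gt x
  rw [(smoothStaircase_eventuallyEq c hN).deriv_eq]
  have hmono : Monotone fun y => stepSum c N y - y := by
    intro y z hyz
    simp only [stepSum, add_sub_cancel_left]
    refine Finset.sum_le_sum fun k _ => mul_le_mul_of_nonneg_left ?_ (hc k)
    exact smoothTransition.monotone (by linarith)
  have hd : DifferentiableAt ℝ (stepSum c N) x :=
    (contDiff_stepSum c N).differentiable (by simp) x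
  have h := hmono.deriv_nonneg (x := x)
  rw [deriv_fun_sub hd differentiableAt_fun_id, deriv_id''] at h
  linarith

theorem deriv_smoothStaircase_eq_one (c : ℕ → ℝ) (k : ℕ) {x : ℝ}
    (hx : x ∈ Set.Ioo (k : ℝ) (k + 7 / 8)) : deriv (smoothStaircase c) x = 1 := by
  have h : smoothStaircase c =ᶠ[nhds x] fun y => y + ∑ j ∈ Finset.range k, c j := by
    filter_upwards [Ioo_mem_nhds hx.1 hx.2] with y hy
    rw [smoothStaircase_eq_stepSum c (N := k + 1) (by push_cast; linarith [hy.2]), stepSum,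
      Finset.sum_range_succ, smoothTransition.zero_of_nonpos (by linarith [hy.2]), mul_zero,
      add_zero]
    congr 1
    refine Finset.sum_congr rfl fun j hj => ?_
    have hjk : (j : ℝ) + 1 ≤ k := by exact_mod_cast Finset.mem_range.1 hj
    rw [smoothTransition.one_of_one_le (by linarith [hy.1]), mul_one]
  rw [h.deriv_eq]
  exact ((hasDerivAt_id' x).add_const _).deriv

theorem le_smoothStaircase_natCast_succ {c : ℕ → ℝ} (hc : ∀ k, 0 ≤ c k) (k : ℕ) :
    c k ≤ smoothStaircase c ((k + 1 : ℕ) : ℝ) := by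
  have h := Finset.single_le_sum (s := Finset.range (k + 1))
    (f := fun j => c j * smoothTransition (8 * (((k + 1 : ℕ) : ℝ) - j) - 7))
    (fun j _ => mul_nonneg (hc j) (smoothTransition.nonneg _)) (Finset.self_mem_range_succ k)
  rw [smoothTransition.one_of_one_le (by push_cast; linarith), mul_one] at h
  rw [smoothStaircase_eq_stepSum c le_rfl, stepSum]
  exact h.trans (le_add_of_nonneg_left (Nat.cast_nonneg _))

/-- Given a nondecreasing nonnegative F on [0,∞), there is a smooth V with V(0) = 0,
V' > 0 on [0,∞), V(k) ≥ F(k+1) for integers k ≥ 1, and V' constant on each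
interval [k + 1/8, k + 3/4]. -/
theorem stmt_10 (F : ℝ → ℝ) (hFmono : MonotoneOn F (Set.Ici (0 : ℝ)))
    (hFnonneg : ∀ r : ℝ, 0 ≤ r → 0 ≤ F r) :
    ∃ V : ℝ → ℝ, ContDiff ℝ (⊤ : ℕ∞) V ∧ V 0 = 0 ∧
      (∀ r : ℝ, 0 ≤ r → 0 < deriv V r) ∧
      (∀ k : ℕ, 1 ≤ k → F ((k : ℝ) + 1) ≤ V (k : ℝ)) ∧
      (∀ k : ℕ, 1 ≤ k → ∀ x ∈ Set.Icc ((k : ℝ) + 1/8) ((k : ℝ) + 3/4),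
        ∀ y ∈ Set.Icc ((k : ℝ) + 1/8) ((k : ℝ) + 3/4), deriv V x = deriv V y) := by
  set c : ℕ → ℝ := fun k => F (((k + 1 : ℕ) : ℝ) + 1)
  have hc : ∀ k, 0 ≤ c k := fun k => hFnonneg _ (by positivity)
  have hone : ∀ k : ℕ, ∀ x ∈ Set.Icc ((k : ℝ) + 1/8) ((k : ℝ) + 3/4),
      deriv (smoothStaircase c) x = 1 := fun k x hx =>
    deriv_smoothStaircase_eq_one c k ⟨by linarith [hx.1], by linarith [hx.2]⟩
  refine ⟨smoothStaircase c, contDiff_smoothStaircase c, by simp [smoothStaircase, stepSum],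
    fun r _ => deriv_smoothStaircase_pos hc r, fun k hk => ?_, fun k _ x hx y hy => ?_⟩
  · obtain ⟨m, rfl⟩ := Nat.exists_eq_add_of_le' hk
    exact le_smoothStaircase_natCast_succ hc m
  · rw [hone k x hx, hone k y hy]
end

section
/- There exist infinitely differentiable functions S₁, S₂ : (0, ∞) → ℝ, both everywhere positive, such that: S₁(r) = S₂(r) = 2πr for 0 < r ≤ 1; S₁(r) + S₂(r) = 3r²·exp(r³) for all r ≥ 2; S₁(r) = 1 for all r ∈ [4k, 4k + 1] for every integer k ≥ 1; and S₂(r) = 1 for all r ∈ [4k + 2, 4k + 3] for every integer k ≥ 1. -/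
open Real

/-- A smooth `4`-periodic function with values in `[0, 1]`, equal to `1` on `[4k, 4k + 1]` and to
`0` on `[4k + 2, 4k + 3]`. -/
noncomputable def periodicSwitch (r : ℝ) : ℝ :=
  smoothTransition (cos (π / 2 * (r - 1 / 2)) + 1 / 2)

lemma periodicSwitch_contDiff : ContDiff ℝ (⊤ : ℕ∞) periodicSwitch :=
  smoothTransition.contDiff.comp (by fun_prop)

lemma half_le_cos_of_abs_le {x : ℝ} (hx : |x| ≤ π / 4) : 1 / 2 ≤ cos x := by
  rw [← cos_abs, ← cos_pi_div_three]
  exact cos_le_cos_of_nonneg_of_le_pi (abs_nonneg x) (by linarith [pi_pos])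
    (by linarith [pi_pos])

lemma periodicSwitch_eq_one (k : ℕ) {r : ℝ} (hr : r ∈ Set.Icc (4 * (k : ℝ)) (4 * (k : ℝ) + 1)) :
    periodicSwitch r = 1 := by
  apply smoothTransition.one_of_one_le
  have h : π / 2 * (r - 1 / 2) = π / 2 * (r - 1 / 2 - 4 * k) + k * (2 * π) := by ring
  rw [h, cos_add_nat_mul_two_pi]
  have := half_le_cos_of_abs_le (x := π / 2 * (r - 1 / 2 - 4 * k))
    (abs_le.2 ⟨by nlinarith [pi_pos, hr.1], by nlinarith [pi_pos, hr.2]⟩)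
  linarith

lemma periodicSwitch_eq_zero (k : ℕ) {r : ℝ}
    (hr : r ∈ Set.Icc (4 * (k : ℝ) + 2) (4 * (k : ℝ) + 3)) : periodicSwitch r = 0 := by
  apply smoothTransition.zero_of_nonpos
  have h : π / 2 * (r - 1 / 2) = π / 2 * (r - 5 / 2 - 4 * k) + π + k * (2 * π) := by ring
  rw [h, cos_add_nat_mul_two_pi, cos_add_pi]
  have := half_le_cos_of_abs_le (x := π / 2 * (r - 5 / 2 - 4 * k))
    (abs_le.2 ⟨by nlinarith [pi_pos, hr.1], by nlinarith [pi_pos, hr.2]⟩)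
  linarith

lemma one_lt_three_mul_sq_mul_exp {r : ℝ} (hr : 1 ≤ r) : 1 < 3 * r ^ 2 * exp (r ^ 3) := by
  have h₁ : 1 ≤ r ^ 2 := one_le_pow₀ hr
  have h₂ : 1 ≤ exp (r ^ 3) := one_le_exp (by positivity)
  nlinarith

lemma convex_combination_pos {t a b : ℝ} (h₀ : 0 ≤ t) (h₁ : t ≤ 1) (ha : 0 < a) (hb : 0 < b) :
    0 < (1 - t) * a + t * b :=
  convex_Ioi (0 : ℝ) ha hb (sub_nonneg.2 h₁) h₀ (sub_add_cancel 1 t)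

/-- The function interpolating between `2πr` on `(0, 1]` and, on `[2, ∞)`, the weighted mean of `1`
and `3r²exp(r³) - 1` with weights `φ` and `1 - φ`. -/
noncomputable def areaProfile (φ : ℝ → ℝ) (r : ℝ) : ℝ :=
  (1 - smoothTransition (r - 1)) * (2 * π * r) +
    smoothTransition (r - 1) * ((1 - φ r) * (3 * r ^ 2 * exp (r ^ 3) - 1) + φ r * 1)

lemma areaProfile_contDiff {φ : ℝ → ℝ} (hφ : ContDiff ℝ (⊤ : ℕ∞) φ) :
    ContDiff ℝ (⊤ : ℕ∞) (areaProfile φ) := by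
  have h : ContDiff ℝ (⊤ : ℕ∞) fun r : ℝ => smoothTransition (r - 1) :=
    smoothTransition.contDiff.comp (by fun_prop)
  unfold areaProfile
  fun_prop

lemma areaProfile_of_le_one (φ : ℝ → ℝ) {r : ℝ} (hr : r ≤ 1) : areaProfile φ r = 2 * π * r := by
  simp [areaProfile, smoothTransition.zero_of_nonpos (sub_nonpos.2 hr)]

lemma areaProfile_of_two_le (φ : ℝ → ℝ) {r : ℝ} (hr : 2 ≤ r) :
    areaProfile φ r = (1 - φ r) * (3 * r ^ 2 * exp (r ^ 3) - 1) + φ r := by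
  simp [areaProfile, smoothTransition.one_of_one_le (show 1 ≤ r - 1 by linarith)]

lemma areaProfile_pos {φ : ℝ → ℝ} (h₀ : ∀ r, 0 ≤ φ r) (h₁ : ∀ r, φ r ≤ 1) {r : ℝ} (hr : 0 < r) :
    0 < areaProfile φ r := by
  rcases le_total r 1 with h | h
  · rw [areaProfile_of_le_one φ h]
    positivity
  · exact convex_combination_pos (smoothTransition.nonneg _) (smoothTransition.le_one _)
      (by positivity) (convex_combination_pos (h₀ r) (h₁ r)
        (sub_pos.2 (one_lt_three_mul_sq_mul_exp h)) one_pos)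

/-- There exist smooth positive functions S₁, S₂ on (0,∞) with S₁(r) = S₂(r) = 2πr for
0 < r ≤ 1, S₁(r) + S₂(r) = 3r²·exp(r³) for r ≥ 2, S₁ ≡ 1 on each [4k, 4k+1] and
S₂ ≡ 1 on each [4k+2, 4k+3] for integers k ≥ 1. -/
theorem stmt_14 :
    ∃ S₁ S₂ : ℝ → ℝ,
      ContDiffOn ℝ (⊤ : ℕ∞) S₁ (Set.Ioi (0 : ℝ)) ∧ ContDiffOn ℝ (⊤ : ℕ∞) S₂ (Set.Ioi (0 : ℝ)) ∧
      (∀ r ∈ Set.Ioi (0 : ℝ), 0 < S₁ r) ∧ (∀ r ∈ Set.Ioi (0 : ℝ), 0 < S₂ r) ∧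
      (∀ r : ℝ, 0 < r → r ≤ 1 → S₁ r = 2 * Real.pi * r ∧ S₂ r = 2 * Real.pi * r) ∧
      (∀ r : ℝ, 2 ≤ r → S₁ r + S₂ r = 3 * r ^ 2 * Real.exp (r ^ 3)) ∧
      (∀ k : ℕ, 1 ≤ k → ∀ r ∈ Set.Icc (4 * (k : ℝ)) (4 * (k : ℝ) + 1), S₁ r = 1) ∧
      (∀ k : ℕ, 1 ≤ k → ∀ r ∈ Set.Icc (4 * (k : ℝ) + 2) (4 * (k : ℝ) + 3), S₂ r = 1) := by
  have h₀ : ∀ r, 0 ≤ periodicSwitch r := fun _ => smoothTransition.nonneg _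
  have h₁ : ∀ r, periodicSwitch r ≤ 1 := fun _ => smoothTransition.le_one _
  refine ⟨areaProfile periodicSwitch, areaProfile fun r => 1 - periodicSwitch r,
    (areaProfile_contDiff periodicSwitch_contDiff).contDiffOn,
    (areaProfile_contDiff (contDiff_const.sub periodicSwitch_contDiff)).contDiffOn,
    fun r hr => areaProfile_pos h₀ h₁ hr,
    fun r hr => areaProfile_pos (fun r => sub_nonneg.2 (h₁ r)) (fun r => sub_le_self 1 (h₀ r)) hr,
    fun r _ hr => ⟨areaProfile_of_le_one _ hr, areaProfile_of_le_one _ hr⟩,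
    fun r hr => ?_, fun k hk r hr => ?_, fun k hk r hr => ?_⟩
  · rw [areaProfile_of_two_le _ hr, areaProfile_of_two_le _ hr]
    ring
  · have hk' : (1 : ℝ) ≤ k := by exact_mod_cast hk
    rw [areaProfile_of_two_le _ (by linarith [hr.1]), periodicSwitch_eq_one k hr]
    ring
  · have hk' : (1 : ℝ) ≤ k := by exact_mod_cast hk
    rw [areaProfile_of_two_le _ (by linarith [hr.1]), periodicSwitch_eq_zero k hr]
    ring
end
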